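/- If 0 < n < m and the random vectors (X₁,…,X_n) and (X_{n+1},…,X_m) are independent of each other, then the joint cumulant ⟨X₁,…,X_m⟩ equals 0. -/

import Mathlib

open MeasureTheory ProbabilityTheory Finset


open MeasureTheory ProbabilityTheory Finset

/-- `IsPartitionOf P T` : `P` is a partition of the finset `T` into nonempty,
pairwise disjoint parts. -/
def IsPartitionOf {ι : Type*} [DecidableEq ι] (P : Finset (Finset ι)) (T : Finset ι) : Prop :=
  (∀ S ∈ P, S.Nonempty) ∧ (P : Set (Finset ι)).PairwiseDisjoint id ∧ P.sup id = T

open Classical in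
/-- The joint cumulant (semi-invariant) of the random variables `X i`, `i ∈ T`. -/
noncomputable def jointCumulant {Ω ι : Type*} [MeasurableSpace Ω] [DecidableEq ι]
    (μ : Measure Ω) (X : ι → Ω → ℝ) (T : Finset ι) : ℝ :=
  ∑ P ∈ T.powerset.powerset.filter (fun P => IsPartitionOf P T),
    (-1 : ℝ) ^ (P.card - 1) * (P.card - 1).factorial *
      ∏ S ∈ P, ∫ ω, ∏ i ∈ S, X i ω ∂μ

open Classical in
/-- The finset of all partitions of `T`. -/
noncomputable def parts {ι : Type*} [DecidableEq ι] (T : Finset ι) : Finset (Finset (Finset ι)) :=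
  T.powerset.powerset.filter (fun P => IsPartitionOf P T)

theorem IsPartitionOf.subset {ι : Type*} [DecidableEq ι] {P : Finset (Finset ι)} {T S : Finset ι}
    (h : IsPartitionOf P T) (hS : S ∈ P) : S ⊆ T := by
  have h2 := h.2.2
  rw [← h2]
  exact Finset.le_sup (f := id) hS

theorem mem_parts {ι : Type*} [DecidableEq ι] {P : Finset (Finset ι)} {T : Finset ι} :
    P ∈ parts T ↔ IsPartitionOf P T := by
  unfold parts
  simp only [Finset.mem_filter, Finset.mem_powerset, and_iff_right_iff_imp]
  intro h S hS
  exact Finset.mem_powerset.2 (h.subset hS)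

theorem isPart_iff {ι : Type*} [DecidableEq ι] {P : Finset (Finset ι)} {T : Finset ι} :
    IsPartitionOf P T ↔ (∀ S ∈ P, S.Nonempty) ∧
      (∀ S ∈ P, ∀ S' ∈ P, ∀ x, x ∈ S → x ∈ S' → S = S') ∧ (∀ x, x ∈ T ↔ ∃ S ∈ P, x ∈ S) := by
  unfold IsPartitionOf
  refine and_congr Iff.rfl (and_congr ?_ ?_)
  · constructor
    · intro h S hS S' hS' x hx hx'
      by_contra hne
      exact Finset.disjoint_left.1 (h hS hS' hne) hx hx'
    · intro h S hS S' hS' hne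
      exact Finset.disjoint_left.2 (fun x hx hx' => hne (h S hS S' hS' x hx hx'))
  · rw [Finset.ext_iff]
    simp only [Finset.mem_sup, id]
    exact forall_congr' fun x => Iff.comm

theorem isPart_insert {ι : Type*} [DecidableEq ι] {P : Finset (Finset ι)} {T S : Finset ι}
    (hS : S ⊆ T) (hne : S ≠ T) (h : IsPartitionOf P S) :
    IsPartitionOf (insert (T \ S) P) T ∧ T \ S ∉ P := by
  have hsub := fun B (hB : B ∈ P) => h.subset hB
  have hnon : (T \ S).Nonempty := by
    rw [Finset.sdiff_nonempty]
    exact fun h => hne (subset_antisymm hS h)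
  rw [isPart_iff] at h ⊢
  obtain ⟨h1, h2, h3⟩ := h
  refine ⟨⟨?_, ?_, ?_⟩, ?_⟩
  · intro B hB
    rcases Finset.mem_insert.1 hB with rfl | hB
    · exact hnon
    · exact h1 B hB
  · intro B hB B' hB' x hx hx'
    rcases Finset.mem_insert.1 hB with rfl | hB <;> rcases Finset.mem_insert.1 hB' with rfl | hB'
    · rfl
    · exact absurd (hsub _ hB' hx') (Finset.mem_sdiff.1 hx).2
    · exact absurd (hsub _ hB hx) (Finset.mem_sdiff.1 hx').2
    · exact h2 B hB B' hB' x hx hx'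
  · intro x
    by_cases hx : x ∈ S
    · have := (h3 x).1 hx
      simp [hS hx, this, hx]
    · have := mt (h3 x).2 hx
      simp only [Finset.mem_insert, exists_eq_or_imp, Finset.mem_sdiff, this, or_false]
      tauto
  · intro hm
    obtain ⟨x, hx⟩ := hnon
    exact (Finset.mem_sdiff.1 hx).2 (hsub _ hm hx)

theorem isPart_erase {ι : Type*} [DecidableEq ι] {Q : Finset (Finset ι)} {T B : Finset ι}
    (h : IsPartitionOf Q T) (hB : B ∈ Q) : IsPartitionOf (Q.erase B) (T \ B) := by
  rw [isPart_iff] at h ⊢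
  obtain ⟨h1, h2, h3⟩ := h
  refine ⟨fun S hS => h1 S (Finset.mem_of_mem_erase hS), fun S hS S' hS' =>
    h2 S (Finset.mem_of_mem_erase hS) S' (Finset.mem_of_mem_erase hS'), ?_⟩
  intro x
  rw [Finset.mem_sdiff, h3]
  constructor
  · rintro ⟨⟨S, hS, hx⟩, hxB⟩
    exact ⟨S, Finset.mem_erase.2 ⟨fun e => hxB (e ▸ hx), hS⟩, hx⟩
  · rintro ⟨S, hS, hx⟩
    obtain ⟨hne, hS⟩ := Finset.mem_erase.1 hS
    exact ⟨⟨S, hS, hx⟩, fun hxB => hne (h2 S hS B hB x hx hxB)⟩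

/-- weight of a partition -/
noncomputable def wt {ι : Type*} (M : Finset ι → ℝ) (P : Finset (Finset ι)) : ℝ :=
  (-1 : ℝ) ^ (P.card - 1) * (P.card - 1).factorial * ∏ S ∈ P, M S

/-- formal cumulant -/
noncomputable def kap {ι : Type*} [DecidableEq ι] (M : Finset ι → ℝ) (T : Finset ι) : ℝ :=
  ∑ P ∈ parts T, wt M P

theorem kap_aux {ι : Type*} [DecidableEq ι] (M : Finset ι → ℝ) (T : Finset ι) (t : ι) (ht : t ∈ T) :
    ∑ S ∈ T.powerset.filter (fun S => t ∈ S ∧ S ≠ T), kap M S * M (T \ S) =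
    ∑ Q ∈ parts T, ∑ B ∈ Q.filter (fun B => t ∉ B), wt M (Q.erase B) * M B := by
  unfold kap
  simp only [Finset.sum_mul]
  rw [Finset.sum_sigma', Finset.sum_sigma']
  refine Finset.sum_bij' (fun x _ => ⟨insert (T \ x.1) x.2, T \ x.1⟩)
    (fun y _ => ⟨T \ y.2, y.1.erase y.2⟩) ?_ ?_ ?_ ?_ ?_
  · rintro ⟨S, P⟩ hx
    simp only [Finset.mem_sigma, Finset.mem_filter, Finset.mem_powerset, mem_parts] at hx ⊢
    obtain ⟨⟨hS, htS, hne⟩, hP⟩ := hx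
    refine ⟨(isPart_insert hS hne hP).1, Finset.mem_insert_self _ _, ?_⟩
    simp [htS]
  · rintro ⟨Q, B⟩ hx
    simp only [Finset.mem_sigma, Finset.mem_filter, Finset.mem_powerset, mem_parts] at hx ⊢
    obtain ⟨hQ, hB, htB⟩ := hx
    refine ⟨⟨Finset.sdiff_subset, Finset.mem_sdiff.2 ⟨ht, htB⟩, ?_⟩, isPart_erase hQ hB⟩
    intro e
    obtain ⟨x, hxB⟩ := hQ.1 B hB
    have hxT := hQ.subset hB hxB
    rw [← e] at hxT
    exact (Finset.mem_sdiff.1 hxT).2 hxB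
  · rintro ⟨S, P⟩ hx
    simp only [Finset.mem_sigma, Finset.mem_filter, Finset.mem_powerset, mem_parts] at hx ⊢
    obtain ⟨⟨hS, htS, hne⟩, hP⟩ := hx
    rw [Finset.erase_insert (isPart_insert hS hne hP).2, Finset.sdiff_sdiff_eq_self hS]
  · rintro ⟨Q, B⟩ hx
    simp only [Finset.mem_sigma, Finset.mem_filter, mem_parts] at hx ⊢
    obtain ⟨hQ, hB, htB⟩ := hx
    rw [Finset.sdiff_sdiff_eq_self (hQ.subset hB), Finset.insert_erase hB]
  · rintro ⟨S, P⟩ hx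
    simp only [Finset.mem_sigma, Finset.mem_filter, Finset.mem_powerset, mem_parts] at hx ⊢
    obtain ⟨⟨hS, htS, hne⟩, hP⟩ := hx
    rw [Finset.erase_insert (isPart_insert hS hne hP).2]

theorem wt_cancel {ι : Type*} [DecidableEq ι] (M : Finset ι → ℝ) (T : Finset ι) (t : ι)
    (ht : t ∈ T) (Q : Finset (Finset ι)) (hQ : IsPartitionOf Q T) :
    wt M Q + ∑ B ∈ Q.filter (fun B => t ∉ B), wt M (Q.erase B) * M B =
      if Q = {T} then M T else 0 := by
  have hQ' := isPart_iff.1 hQ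
  obtain ⟨B0, hB0, htB0⟩ := (hQ'.2.2 t).1 ht
  have hf : Q.filter (fun B => t ∉ B) = Q.erase B0 := by
    ext B
    simp only [Finset.mem_filter, Finset.mem_erase]
    constructor
    · rintro ⟨hB, htB⟩
      exact ⟨fun e => htB (e ▸ htB0), hB⟩
    · rintro ⟨hne, hB⟩
      exact ⟨hB, fun htB => hne (hQ'.2.1 B hB B0 hB0 t htB htB0)⟩
  have hterm : ∀ B ∈ Q.erase B0, wt M (Q.erase B) * M B =
      (-1 : ℝ) ^ (Q.card - 2) * (Q.card - 2).factorial * ∏ S ∈ Q, M S := by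
    intro B hB
    have hB := Finset.mem_of_mem_erase hB
    unfold wt
    rw [Finset.card_erase_of_mem hB, mul_assoc, Finset.prod_erase_mul _ _ hB, Nat.sub_sub]
  rw [hf, Finset.sum_congr rfl hterm, Finset.sum_const, Finset.card_erase_of_mem hB0]
  have hpos : 0 < Q.card := Finset.card_pos.2 ⟨_, hB0⟩
  split_ifs with h
  · subst h
    simp [wt]
  · have h2 : 2 ≤ Q.card := by
      by_contra hlt
      have h1 : Q.card = 1 := by omega
      obtain ⟨C, rfl⟩ := Finset.card_eq_one.1 h1
      apply h
      have := hQ.2.2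
      simp at this
      rw [this]
    obtain ⟨k, hk⟩ := Nat.exists_eq_add_of_le' h2
    unfold wt
    rw [hk]
    simp only [Nat.add_sub_cancel, show k + 2 - 1 = k + 1 from rfl, Nat.factorial_succ, pow_succ,
      nsmul_eq_mul]
    push_cast
    ring

theorem kap_rec {ι : Type*} [DecidableEq ι] (M : Finset ι → ℝ) (hM : M ∅ = 1) (T : Finset ι)
    (t : ι) (ht : t ∈ T) :
    ∑ S ∈ T.powerset.filter (fun S => t ∈ S), kap M S * M (T \ S) = M T := by
  have hT : T ∈ T.powerset.filter (fun S => t ∈ S) := by simp [ht]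
  rw [← Finset.add_sum_erase _ _ hT]
  have he : (T.powerset.filter (fun S => t ∈ S)).erase T =
      T.powerset.filter (fun S => t ∈ S ∧ S ≠ T) := by
    ext S
    simp only [Finset.mem_erase, Finset.mem_filter]
    tauto
  rw [he, kap_aux M T t ht, Finset.sdiff_self, hM, mul_one, kap, ← Finset.sum_add_distrib,
    Finset.sum_congr rfl (fun Q hQ => wt_cancel M T t ht Q (mem_parts.1 hQ)),
    Finset.sum_ite_eq', if_pos]
  rw [mem_parts]
  refine ⟨?_, ?_, ?_⟩
  · simpa using ⟨t, ht⟩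
  · simp
  · simp

theorem kap_zero {ι : Type*} [DecidableEq ι] (M : Finset ι → ℝ) (hM : M ∅ = 1) (A : Finset ι)
    (hA : ∀ S, M S = M (S ∩ A) * M (S \ A)) (T : Finset ι) :
    (T ∩ A).Nonempty → (T \ A).Nonempty → kap M T = 0 := by
  induction T using Finset.strongInduction with
  | H T ih =>
  rintro ⟨t, ht⟩ hB
  obtain ⟨htT, htA⟩ := Finset.mem_inter.1 ht
  have h1 := kap_rec M hM T t htT
  have h2 := kap_rec M hM (T ∩ A) t ht
  have hT : T ∈ T.powerset.filter (fun S => t ∈ S) := by simp [htT]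
  rw [← Finset.add_sum_erase _ _ hT, Finset.sdiff_self, hM, mul_one] at h1
  have hsub : (T ∩ A).powerset.filter (fun S => t ∈ S) ⊆
      (T.powerset.filter (fun S => t ∈ S)).erase T := by
    intro S hS
    simp only [Finset.mem_erase, Finset.mem_filter, Finset.mem_powerset] at hS ⊢
    refine ⟨?_, hS.1.trans Finset.inter_subset_left, hS.2⟩
    rintro rfl
    obtain ⟨x, hx⟩ := hB
    rw [Finset.mem_sdiff] at hx
    exact hx.2 (Finset.mem_inter.1 (hS.1 hx.1)).2
  have h3 : ∑ S ∈ (T.powerset.filter (fun S => t ∈ S)).erase T, kap M S * M (T \ S) = M T := by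
    rw [← Finset.sum_subset hsub, hA T, ← h2, Finset.sum_mul]
    · refine Finset.sum_congr rfl fun S hS => ?_
      simp only [Finset.mem_filter, Finset.mem_powerset] at hS
      have hSA : ∀ x ∈ S, x ∈ A := fun x hx => (Finset.mem_inter.1 (hS.1 hx)).2
      have e1 : (T \ S) ∩ A = (T ∩ A) \ S := by
        ext x; simp only [Finset.mem_inter, Finset.mem_sdiff]; tauto
      have e2 : (T \ S) \ A = T \ A := by
        ext x
        have := hSA x
        simp only [Finset.mem_sdiff]; tauto
      rw [hA (T \ S), e1, e2]
      ring
    · intro S hS hS'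
      simp only [Finset.mem_erase, Finset.mem_filter, Finset.mem_powerset] at hS hS'
      rw [ih S (Finset.ssubset_iff_subset_ne.2 ⟨hS.2.1, hS.1⟩), zero_mul]
      · exact ⟨t, Finset.mem_inter.2 ⟨hS.2.2, htA⟩⟩
      · rw [Finset.sdiff_nonempty]
        exact fun h => hS' ⟨Finset.subset_inter hS.2.1 h, hS.2.2⟩
  linarith

theorem cumulant_of_independent_blocks {Ω : Type*} [MeasurableSpace Ω] (μ : Measure Ω)
    [IsProbabilityMeasure μ] (m n : ℕ) (hn : 0 < n) (hnm : n < m) (X : Fin m → Ω → ℝ)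
    (hmeas : ∀ i, Measurable (X i))
    (hint : ∀ S : Finset (Fin m), Integrable (fun ω => ∏ i ∈ S, X i ω) μ)
    (hindep : IndepFun
      (fun ω => fun i : Fin n => X (Fin.castLE (le_of_lt hnm) i) ω)
      (fun ω => fun i : Fin (m - n) => X (Fin.cast (Nat.add_sub_cancel' hnm.le) (Fin.natAdd n i)) ω) μ) :
    jointCumulant μ X Finset.univ = 0 := by
  classical
  set M : Finset (Fin m) → ℝ := fun S => ∫ ω, ∏ i ∈ S, X i ω ∂μ with hMdef
  set A : Finset (Fin m) := Finset.univ.filter (fun i => i.val < n) with hAdef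
  have hM : M ∅ = 1 := by simp [hMdef]
  have hA : ∀ S, M S = M (S ∩ A) * M (S \ A) := by
    intro S
    let φ : (Fin n → ℝ) → ℝ := fun v =>
      ∏ i : Fin n, if Fin.castLE (le_of_lt hnm) i ∈ S then v i else 1
    let ψ : (Fin (m - n) → ℝ) → ℝ := fun v =>
      ∏ i : Fin (m - n), if Fin.cast (Nat.add_sub_cancel' hnm.le) (Fin.natAdd n i) ∈ S
        then v i else 1
    have hφ : Measurable φ := by
      refine Finset.measurable_prod _ fun i _ => ?_
      split_ifs <;> fun_prop
    have hψ : Measurable ψ := by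
      refine Finset.measurable_prod _ fun i _ => ?_
      split_ifs <;> fun_prop
    have hI := hindep.comp hφ hψ
    have e1 : (φ ∘ fun ω => fun i : Fin n => X (Fin.castLE (le_of_lt hnm) i) ω) =
        fun ω => ∏ i ∈ S ∩ A, X i ω := by
      funext ω
      simp only [φ, Function.comp]
      rw [← Finset.prod_filter]
      refine Finset.prod_bij (fun i _ => Fin.castLE (le_of_lt hnm) i) ?_ ?_ ?_ ?_
      · intro i hi
        simpa [hAdef] using hi
      · intro i _ j _ h
        simpa [Fin.ext_iff] using h
      · intro j hj
        simp only [hAdef, Finset.mem_inter, Finset.mem_filter, Finset.mem_univ, true_and] at hj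
        exact ⟨⟨j.val, hj.2⟩, by simpa using hj.1, rfl⟩
      · intros; rfl
    have e2 : (ψ ∘ fun ω => fun i : Fin (m - n) =>
        X (Fin.cast (Nat.add_sub_cancel' hnm.le) (Fin.natAdd n i)) ω) =
        fun ω => ∏ i ∈ S \ A, X i ω := by
      funext ω
      simp only [ψ, Function.comp]
      rw [← Finset.prod_filter]
      refine Finset.prod_bij
        (fun i _ => Fin.cast (Nat.add_sub_cancel' hnm.le) (Fin.natAdd n i)) ?_ ?_ ?_ ?_
      · intro i hi
        simpa [hAdef] using hi
      · intro i _ j _ h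
        simpa [Fin.ext_iff] using h
      · intro j hj
        simp only [hAdef, Finset.mem_sdiff, Finset.mem_filter, Finset.mem_univ, true_and,
          not_lt] at hj
        have hj' : Fin.cast (Nat.add_sub_cancel' hnm.le)
            (Fin.natAdd n (⟨j.val - n, by omega⟩ : Fin (m - n))) = j := by
          ext
          simp
          omega
        refine ⟨⟨j.val - n, by omega⟩, ?_, hj'⟩
        rw [Finset.mem_filter, hj']
        exact ⟨Finset.mem_univ _, hj.1⟩
      · intros; rfl
    rw [e1, e2] at hI
    have := hI.integral_fun_mul_eq_mul_integral (hint _).aestronglyMeasurable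
      (hint _).aestronglyMeasurable
    simp only [hMdef]
    rw [← this]
    congr 1
    funext ω
    exact (Finset.prod_inter_mul_prod_sdiff S A _).symm
  have hk := kap_zero M hM A hA Finset.univ
    ⟨⟨0, by omega⟩, by simpa [hAdef] using hn⟩ ⟨⟨n, hnm⟩, by simp [hAdef]⟩
  rw [← hk]
  unfold jointCumulant kap parts wt
  congr!
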